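/- Let x be either the relativistic map x_R(y) = −e^{−y} or the CGHS map x_C(y) = −log(1 + e^{−y}). Let f be a normalized outgoing wave function and g a normalized incoming wave function such that the left limit g(0⁻) = lim_{x→0⁻} g(x) exists. Suppose there exist constants α > 0, C > 0 and L ≥ 0 such that |f(y)| ≤ C/|y|^{1+α} for all y ≤ −L. Then there exists Y such that for all y₀ ≥ Y, |N̄_g[f_{y₀}] − N̄_o[f_{y₀}]| ≤ (∫_{−∞}^0 |g(x)| dx)² · 4C²/(α² (y₀/2 + L)^{2α}) + e^{2L − y₀} (∫_ℝ |f(y)| dy)² |g(0⁻)|². -/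

import Mathlib

open MeasureTheory Set Filter
open scoped ENNReal

/-- The Fourier transform `f̂(p) = (2π)^{-1/2} ∫ f(y) e^{-ipy} dy`. -/
noncomputable def ft (f : ℝ → ℂ) (p : ℝ) : ℂ :=
  (Real.sqrt (2 * Real.pi) : ℂ)⁻¹ *
    ∫ y : ℝ, f y * Complex.exp (-Complex.I * (p : ℂ) * (y : ℂ))

/-- `F̌(k) = (2π)^{-1/2} ∫ f(y) e^{-ik x(y)} dy`. -/
noncomputable def Fk (x : ℝ → ℝ) (f : ℝ → ℂ) (k : ℝ) : ℂ :=
  (Real.sqrt (2 * Real.pi) : ℂ)⁻¹ *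
    ∫ y : ℝ, f y * Complex.exp (-Complex.I * (k : ℂ) * (x y : ℂ))

/-- The relativistic black-hole coordinate map `x_R(y) = -e^{-y}`. -/
noncomputable def xR (y : ℝ) : ℝ := -Real.exp (-y)

/-- The CGHS black-hole coordinate map `x_C(y) = -log(1+e^{-y})`. -/
noncomputable def xC (y : ℝ) : ℝ := -Real.log (1 + Real.exp (-y))

/-- The mean number of spontaneously created particles `N̄_o[f]`. -/
noncomputable def No (x : ℝ → ℝ) (f : ℝ → ℂ) : ℝ≥0∞ :=
  ∫⁻ k in Set.Ioi (0:ℝ), ENNReal.ofReal (‖Fk x f (-k)‖ ^ 2 / (2 * k))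

/-- The thermal mean particle number `N̄^Th_β[f]` at inverse temperature `β`. -/
noncomputable def Nth (β : ℝ) (f : ℝ → ℂ) : ℝ≥0∞ :=
  ∫⁻ p in Set.Ioi (0:ℝ),
    ENNReal.ofReal (‖ft f p‖ ^ 2 / (2 * p * (Real.exp (β * p) - 1)))

/-- translate of `f` by `y₀`. -/
noncomputable def tr (f : ℝ → ℂ) (y₀ : ℝ) : ℝ → ℂ := fun y => f (y - y₀)

/-- `⟨g̃, Af̃⟩ = ∫_0^∞ conj(ĝ(k)) F̌(k)/(2k) dk`. -/
noncomputable def Aip (x : ℝ → ℝ) (g f : ℝ → ℂ) : ℂ :=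
  ∫ k in Set.Ioi (0:ℝ), (starRingEnd ℂ) (ft g k) * Fk x f k / (2 * (k : ℂ))

/-- `⟨g̃*, Bf̃⟩ = ∫_0^∞ ĝ(k) F̌(-k)/(2k) dk`. -/
noncomputable def Bip (x : ℝ → ℝ) (g f : ℝ → ℂ) : ℂ :=
  ∫ k in Set.Ioi (0:ℝ), ft g k * Fk x f (-k) / (2 * (k : ℂ))

/-- Wald's formula: the mean number of particles emitted when the incoming state is
the one-particle state `Ω_g`:  `N̄_g[f] = N̄_o[f] + |⟨g̃,Af̃⟩|² + |⟨g̃*,Bf̃⟩|²`. -/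
noncomputable def Ng (x : ℝ → ℝ) (g f : ℝ → ℂ) : ℝ≥0∞ :=
  No x f + ENNReal.ofReal (‖Aip x g f‖ ^ 2) + ENNReal.ofReal (‖Bip x g f‖ ^ 2)

theorem norm_exp_neg_I_mul_mul (k s : ℝ) :
    ‖Complex.exp (-Complex.I * (k : ℂ) * (s : ℂ))‖ = 1 := by
  rw [Complex.norm_exp]
  simp

theorem norm_exp_I_mul_mul (k s : ℝ) :
    ‖Complex.exp (Complex.I * (k : ℂ) * (s : ℂ))‖ = 1 := by
  rw [Complex.norm_exp]
  simp

section Superposition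

variable {Z : Type*} [MeasurableSpace Z] {μ : Measure Z} [SFinite μ]
  {φ : Z → ℂ} {ξ : Z → ℝ} {g : ℝ → ℂ}

theorem integrable_prod_mul_translate (hφ : Integrable φ μ) (hξ : Measurable ξ)
    (hg : Integrable g) :
    Integrable (fun p : Z × ℝ => φ p.1 * g (p.2 + ξ p.1)) (μ.prod volume) := by
  have hmp : MeasurePreserving (fun p : Z × ℝ => (p.1, p.2 + ξ p.1))
      (μ.prod volume) (μ.prod volume) := by
    refine (MeasurePreserving.id μ).skew_product (g := fun z s => s + ξ z) ?_ ?_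
    · exact measurable_snd.add (hξ.comp measurable_fst)
    · exact Eventually.of_forall fun z => (measurePreserving_add_right volume (ξ z)).map_eq
  exact hmp.integrable_comp_of_integrable (hφ.mul_prod hg)

theorem integrable_superposition (hφ : Integrable φ μ) (hξ : Measurable ξ)
    (hg : Integrable g) : Integrable (fun s : ℝ => ∫ z, φ z * g (s + ξ z) ∂μ) :=
  (integrable_prod_mul_translate hφ hξ hg).integral_prod_right

theorem fourier_superposition (hφ : Integrable φ μ) (hξ : Measurable ξ)
    (hg : Integrable g) (k : ℝ) :
    ∫ s : ℝ, (∫ z, φ z * g (s + ξ z) ∂μ) * Complex.exp (-Complex.I * (k : ℂ) * (s : ℂ)) =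
      (∫ z, φ z * Complex.exp (Complex.I * (k : ℂ) * (ξ z : ℂ)) ∂μ) *
        ∫ s : ℝ, g s * Complex.exp (-Complex.I * (k : ℂ) * (s : ℂ)) := by
  have hint : Integrable (fun p : Z × ℝ => φ p.1 * g (p.2 + ξ p.1) *
      Complex.exp (-Complex.I * (k : ℂ) * (p.2 : ℂ))) (μ.prod volume) := by
    refine (integrable_prod_mul_translate hφ hξ hg).mul_bdd (c := 1) ?_ ?_
    · exact (by fun_prop : Continuous fun p : ℝ =>
        Complex.exp (-Complex.I * (k : ℂ) * (p : ℂ))).aestronglyMeasurable.comp_snd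
    · exact Eventually.of_forall fun p => (norm_exp_neg_I_mul_mul k p.2).le
  calc
    _ = ∫ s : ℝ, ∫ z, φ z * g (s + ξ z) * Complex.exp (-Complex.I * (k : ℂ) * (s : ℂ)) ∂μ := by
      simp_rw [integral_mul_const]
    _ = ∫ z, (∫ s : ℝ, φ z * g (s + ξ z) *
          Complex.exp (-Complex.I * (k : ℂ) * (s : ℂ))) ∂μ :=
      (integral_integral_swap hint).symm
    _ = ∫ z, φ z * Complex.exp (Complex.I * (k : ℂ) * (ξ z : ℂ)) *
          (∫ s : ℝ, g s * Complex.exp (-Complex.I * (k : ℂ) * (s : ℂ))) ∂μ := by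
      refine integral_congr_ae (Eventually.of_forall fun z => ?_)
      dsimp only
      rw [← integral_add_right_eq_self
        (fun s : ℝ => g s * Complex.exp (-Complex.I * (k : ℂ) * (s : ℂ))) (ξ z),
        ← integral_const_mul]
      refine integral_congr_ae (Eventually.of_forall fun s => ?_)
      dsimp only
      have : Complex.exp (-Complex.I * (k : ℂ) * (s : ℂ)) =
          Complex.exp (Complex.I * (k : ℂ) * (ξ z : ℂ)) *
            Complex.exp (-Complex.I * (k : ℂ) * ((s + ξ z : ℝ) : ℂ)) := by
        rw [← Complex.exp_add]
        congr 1
        push_cast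
        ring
      rw [this]
      ring
    _ = _ := integral_mul_const _ _

end Superposition

theorem apply_zero_eq_integral_fourier {P : ℝ → ℂ} (hc : Continuous P) (hP : Integrable P)
    (hF : Integrable fun k : ℝ => ∫ s : ℝ, P s * Complex.exp (-Complex.I * (k : ℂ) * (s : ℂ))) :
    P 0 = (2 * Real.pi : ℂ)⁻¹ *
      ∫ k : ℝ, ∫ s : ℝ, P s * Complex.exp (-Complex.I * (k : ℂ) * (s : ℂ)) := by
  set U : ℝ → ℂ := fun k => ∫ s : ℝ, P s * Complex.exp (-Complex.I * (k : ℂ) * (s : ℂ))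
  have h2π : (2 * Real.pi) ≠ 0 := by positivity
  have hfour : FourierTransform.fourier P = fun w => U (2 * Real.pi * w) := by
    funext w
    rw [Real.fourier_real_eq_integral_exp_smul]
    refine integral_congr_ae (Eventually.of_forall fun s => ?_)
    dsimp only
    rw [smul_eq_mul, mul_comm]
    congr 2
    push_cast
    ring
  have hinv := Continuous.fourierInv_fourier_eq hc hP
    (by rw [hfour]; exact (integrable_comp_mul_left_iff U h2π).2 hF)
  have h0 := congrFun hinv 0
  rw [hfour, Real.fourierInv_eq'] at h0
  simp only [inner_zero_right, mul_zero, Complex.ofReal_zero, zero_mul, Complex.exp_zero,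
    one_smul] at h0
  rw [← h0, Measure.integral_comp_mul_left U, abs_of_pos (by positivity), Complex.real_smul]
  push_cast
  rfl

theorem tendsto_integral_exp_mul_atTop_zero (h : ℝ → ℂ) :
    Tendsto (fun T : ℝ => ∫ k : ℝ, h k * Complex.exp (Complex.I * (k : ℂ) * (T : ℂ)))
      atTop (nhds 0) := by
  have hw : Tendsto (fun T : ℝ => -(2 * Real.pi)⁻¹ * T) atTop (cocompact ℝ) := by
    refine Tendsto.mono_right ?_ atBot_le_cocompact
    exact tendsto_id.const_mul_atTop_of_neg (by simp [Real.pi_pos])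
  refine ((Real.tendsto_integral_exp_smul_cocompact h).comp hw).congr fun T => ?_
  refine integral_congr_ae (Eventually.of_forall fun k => ?_)
  dsimp only
  rw [Circle.smul_def, Real.fourierChar_apply, smul_eq_mul, mul_comm]
  congr 2
  have : (Real.pi : ℂ) ≠ 0 := by exact_mod_cast Real.pi_ne_zero
  push_cast
  field_simp

theorem continuous_ft {f : ℝ → ℂ} (hf : Integrable f) : Continuous (ft f) := by
  refine continuous_const.mul ?_
  refine continuous_of_dominated (bound := fun y => ‖f y‖) ?_ ?_ hf.norm ?_
  · intro p
    exact hf.aestronglyMeasurable.mul (by fun_prop : Continuous fun y : ℝ =>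
      Complex.exp (-Complex.I * (p : ℂ) * (y : ℂ))).aestronglyMeasurable
  · intro p
    exact Eventually.of_forall fun y => by rw [norm_mul, norm_exp_neg_I_mul_mul, mul_one]
  · exact Eventually.of_forall fun y => by fun_prop

theorem integral_eq_zero_of_ft_ae_eq_zero {f : ℝ → ℂ} (hf : Integrable f)
    (hfp : ∀ᵐ p : ℝ, p ≤ 0 → ft f p = 0) : ∫ y, f y = 0 := by
  have h : EqOn (ft f) (fun _ => 0) (Icc (-1) 0) := by
    refine Measure.eqOn_Icc_of_ae_eq volume (by norm_num) ?_
      (continuous_ft hf).continuousOn continuousOn_const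
    filter_upwards [ae_restrict_of_ae hfp, ae_restrict_mem measurableSet_Icc] with p hp hp'
    exact hp hp'.2
  have h0 := h (x := 0) (by norm_num)
  have h2π : Real.sqrt (2 * Real.pi) ≠ 0 := by positivity
  simpa [ft, h2π, Real.pi_ne_zero, Real.pi_pos.le] using h0

theorem norm_intervalIntegral_le_integral_norm {g : ℝ → ℂ} (hg : Integrable g) (a b : ℝ) :
    ‖∫ t in a..b, g t‖ ≤ ∫ t, ‖g t‖ :=
  intervalIntegral.norm_integral_le_integral_norm_uIoc.trans
    (setIntegral_le_integral hg.norm (Eventually.of_forall fun _ => norm_nonneg _))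

theorem continuous_intervalIntegral_window {g : ℝ → ℂ} (hg : Integrable g) (T : ℝ) :
    Continuous fun s : ℝ => ∫ t in s..s + T, g t := by
  have hprim : Continuous fun b : ℝ => ∫ t in (0 : ℝ)..b, g t :=
    intervalIntegral.continuous_primitive (fun _ _ => hg.intervalIntegrable) 0
  have heq : (fun s : ℝ => ∫ t in s..s + T, g t) =
      fun s => (∫ t in (0 : ℝ)..s + T, g t) - ∫ t in (0 : ℝ)..s, g t := by
    funext s
    exact (intervalIntegral.integral_interval_sub_left hg.intervalIntegrable
      hg.intervalIntegrable).symm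
  rw [heq]
  exact (hprim.comp (continuous_id.add continuous_const)).sub hprim

theorem setIntegral_translate_eq_window (g : ℝ → ℂ) {T : ℝ} (hT : 0 ≤ T) (s : ℝ) :
    ∫ t in Ioc 0 T, (1 : ℂ) * g (s + t) = ∫ t in s..s + T, g t := by
  simp_rw [one_mul]
  rw [← intervalIntegral.integral_of_le hT, intervalIntegral.integral_comp_add_left]
  simp

theorem integrable_window {g : ℝ → ℂ} (hg : Integrable g) {T : ℝ} (hT : 0 ≤ T) :
    Integrable fun s : ℝ => ∫ t in s..s + T, g t := by
  simp_rw [← setIntegral_translate_eq_window g hT]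
  exact integrable_superposition (μ := volume.restrict (Ioc 0 T)) (φ := fun _ => 1)
    (ξ := fun t => t) (integrable_const _) measurable_id hg

theorem fourier_window {g : ℝ → ℂ} (hg : Integrable g) {T : ℝ} (hT : 0 ≤ T) {k : ℝ}
    (hk : k ≠ 0) :
    ∫ s : ℝ, (∫ t in s..s + T, g t) * Complex.exp (-Complex.I * (k : ℂ) * (s : ℂ)) =
      (Complex.exp (Complex.I * (k : ℂ) * (T : ℂ)) - 1) / (Complex.I * (k : ℂ)) *
        ∫ s : ℝ, g s * Complex.exp (-Complex.I * (k : ℂ) * (s : ℂ)) := by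
  simp_rw [← setIntegral_translate_eq_window g hT]
  have hIk : Complex.I * (k : ℂ) ≠ 0 :=
    mul_ne_zero Complex.I_ne_zero (Complex.ofReal_ne_zero.2 hk)
  refine (fourier_superposition (μ := volume.restrict (Ioc 0 T)) (φ := fun _ => 1)
    (ξ := fun t => t) (integrable_const _) measurable_id hg k).trans ?_
  congr 1
  simp_rw [one_mul]
  rw [← intervalIntegral.integral_of_le hT, integral_exp_mul_complex hIk]
  simp

/-- The pairing of `g` and `f` in momentum space is half the pairing of a primitive of `g`,
pulled back along `x`, with `f` in position space. -/
theorem Bip_eq_integral_primitive {x : ℝ → ℝ} (hx : Measurable x) {f g : ℝ → ℂ}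
    (hf : Integrable f) (hf0 : ∫ y, f y = 0) (hg : Integrable g)
    (hgp : ∀ᵐ k : ℝ, k ≤ 0 → ft g k = 0)
    (hint : IntegrableOn (fun k : ℝ => ft g k * Fk x f (-k) / (2 * (k : ℂ))) (Ioi 0)) :
    Bip x g f = (2 * Complex.I)⁻¹ * ∫ y, f y * ∫ t in x y..0, g t := by
  set h : ℝ → ℂ := fun k => ft g k * Fk x f (-k) / (2 * (k : ℂ)) with hh_def
  have hind : (Ioi (0 : ℝ)).indicator h =ᵐ[volume] h := by
    filter_upwards [hgp] with k hk
    by_cases hk0 : 0 < k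
    · simp [hk0]
    · simp [hk0, hh_def, hk (not_lt.1 hk0)]
  have hh : Integrable h := ((integrable_indicator_iff measurableSet_Ioi).2 hint).congr hind
  have hBip : Bip x g f = ∫ k, h k := by
    rw [← integral_congr_ae hind, integral_indicator measurableSet_Ioi]
    rfl
  have hc2 : ((Real.sqrt (2 * Real.pi) : ℝ) : ℂ) ^ 2 = 2 * Real.pi := by
    rw [← Complex.ofReal_pow, Real.sq_sqrt (by positivity)]
    push_cast
    rfl
  have hπ : (Real.pi : ℂ) ≠ 0 := by exact_mod_cast Real.pi_ne_zero
  have hc : ((Real.sqrt (2 * Real.pi) : ℝ) : ℂ) ≠ 0 := by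
    intro h0
    rw [h0] at hc2
    simp [hπ] at hc2
  have hexp_int (T : ℝ) :
      Integrable fun k : ℝ => h k * Complex.exp (Complex.I * (k : ℂ) * (T : ℂ)) := by
    refine hh.mul_bdd (c := 1) (by fun_prop : Continuous fun k : ℝ =>
        Complex.exp (Complex.I * (k : ℂ) * (T : ℂ))).aestronglyMeasurable ?_
    exact Eventually.of_forall fun k => (norm_exp_I_mul_mul k T).le
  have hwindow : ∀ T : ℝ, 0 ≤ T → ∫ y, f y * (∫ t in x y..x y + T, g t) =
      2 * Complex.I⁻¹ * ((∫ k : ℝ, h k * Complex.exp (Complex.I * (k : ℂ) * (T : ℂ))) -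
        ∫ k, h k) := by
    intro T hT
    set D : ℝ → ℂ := fun s => ∫ t in s..s + T, g t with hD
    have hDc : Continuous D := continuous_intervalIntegral_window hg T
    have hDi : Integrable D := integrable_window hg hT
    have hPc : Continuous fun s : ℝ => ∫ y, f y * D (s + x y) := by
      refine continuous_of_dominated (bound := fun y => ‖f y‖ * ∫ t, ‖g t‖) ?_ ?_
        (hf.norm.mul_const _) ?_
      · intro s
        exact hf.aestronglyMeasurable.mul
          (hDc.measurable.comp (measurable_const.add hx)).aestronglyMeasurable
      · intro s
        refine Eventually.of_forall fun y => ?_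
        rw [norm_mul]
        gcongr
        exact norm_intervalIntegral_le_integral_norm hg _ _
      · exact Eventually.of_forall fun y => by fun_prop
    have hPF : (fun k : ℝ => ∫ s : ℝ, (∫ y, f y * D (s + x y)) *
          Complex.exp (-Complex.I * (k : ℂ) * (s : ℂ))) =ᵐ[volume]
        fun k => 2 * Real.pi * (2 * Complex.I⁻¹) *
          (h k * Complex.exp (Complex.I * (k : ℂ) * (T : ℂ)) - h k) := by
      filter_upwards [Measure.ae_ne volume (0 : ℝ)] with k hk
      rw [fourier_superposition hf hx hDi k, hD, fourier_window hg hT hk]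
      have hkc : (k : ℂ) ≠ 0 := Complex.ofReal_ne_zero.2 hk
      have hUg : ∫ s : ℝ, g s * Complex.exp (-Complex.I * (k : ℂ) * (s : ℂ)) =
          (Real.sqrt (2 * Real.pi) : ℂ) * ft g k := by
        rw [ft, mul_inv_cancel_left₀ hc]
      have hUf : ∫ y : ℝ, f y * Complex.exp (Complex.I * (k : ℂ) * (x y : ℂ)) =
          (Real.sqrt (2 * Real.pi) : ℂ) * Fk x f (-k) := by
        rw [Fk, mul_inv_cancel_left₀ hc]
        simp
      rw [hUg, hUf, ← hc2, hh_def]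
      field_simp
    have hPi := integrable_superposition hf hx hDi
    have hinv := apply_zero_eq_integral_fourier hPc hPi
      ((((hexp_int T).sub hh).const_mul _).congr hPF.symm)
    rw [integral_congr_ae hPF, integral_const_mul, integral_sub (hexp_int T) hh] at hinv
    simp only [zero_add] at hinv
    rw [hinv, mul_assoc (2 * (Real.pi : ℂ)),
      inv_mul_cancel_left₀ (mul_ne_zero two_ne_zero hπ)]
  have hlim_right : Tendsto (fun T : ℝ => ∫ y, f y * (∫ t in x y..x y + T, g t)) atTop
      (nhds (2 * Complex.I⁻¹ * (0 - ∫ k, h k))) := by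
    refine (((tendsto_integral_exp_mul_atTop_zero h).sub_const _).const_mul _).congr' ?_
    filter_upwards [eventually_ge_atTop 0] with T hT
    exact (hwindow T hT).symm
  have hprim : Continuous fun b : ℝ => ∫ t in b..0, g t := by
    simp_rw [fun b : ℝ => intervalIntegral.integral_symm (f := g) (μ := volume) 0 b]
    exact (intervalIntegral.continuous_primitive (fun _ _ => hg.intervalIntegrable) 0).neg
  have hlim_left : Tendsto (fun T : ℝ => ∫ y, f y * (∫ t in x y..x y + T, g t)) atTop
      (nhds (∫ y, f y * (∫ t in Ioi (x y), g t))) := by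
    refine tendsto_integral_filter_of_dominated_convergence
      (fun y => ‖f y‖ * ∫ t, ‖g t‖) ?_ ?_ (hf.norm.mul_const _) ?_
    · refine Eventually.of_forall fun T => hf.aestronglyMeasurable.mul ?_
      exact ((continuous_intervalIntegral_window hg T).measurable.comp hx).aestronglyMeasurable
    · refine Eventually.of_forall fun T => Eventually.of_forall fun y => ?_
      rw [norm_mul]
      gcongr
      exact norm_intervalIntegral_le_integral_norm hg _ _
    · refine Eventually.of_forall fun y => ?_
      refine (intervalIntegral_tendsto_integral_Ioi (x y) hg.integrableOn ?_).const_mul _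
      exact tendsto_atTop_add_const_left _ _ tendsto_id
  have hsplit : ∫ y, f y * (∫ t in Ioi (x y), g t) = ∫ y, f y * ∫ t in x y..0, g t := by
    have hy : ∀ y, f y * (∫ t in Ioi (x y), g t) =
        f y * (∫ t in x y..0, g t) + f y * ∫ t in Ioi (0 : ℝ), g t := by
      intro y
      rw [← mul_add, intervalIntegral.integral_interval_add_Ioi hg.integrableOn hg.integrableOn]
    simp_rw [hy]
    rw [integral_add ?_ (hf.mul_const _), integral_mul_const, hf0, zero_mul, add_zero]
    refine hf.mul_bdd (c := ∫ t, ‖g t‖) (hprim.measurable.comp hx).aestronglyMeasurable ?_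
    exact Eventually.of_forall fun y => norm_intervalIntegral_le_integral_norm hg _ _
  have hfinal := tendsto_nhds_unique hlim_left hlim_right
  rw [hsplit] at hfinal
  rw [hfinal, hBip, zero_sub]
  have hI : Complex.I ≠ 0 := Complex.I_ne_zero
  field_simp
  rw [Complex.I_sq]
  ring

theorem norm_Bip_le_integral_primitive {x : ℝ → ℝ} (hx : Measurable x) {f g : ℝ → ℂ}
    (hf : Integrable f) (hf0 : ∫ y, f y = 0) (hg : Integrable g)
    (hgp : ∀ᵐ k : ℝ, k ≤ 0 → ft g k = 0) :
    ‖Bip x g f‖ ≤ 2⁻¹ * ∫ y, ‖f y‖ * ‖∫ t in x y..0, g t‖ := by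
  have hnonneg : 0 ≤ ∫ y, ‖f y‖ * ‖∫ t in x y..0, g t‖ :=
    integral_nonneg fun y => by positivity
  by_cases hint : IntegrableOn (fun k : ℝ => ft g k * Fk x f (-k) / (2 * (k : ℂ))) (Ioi 0)
  · rw [Bip_eq_integral_primitive hx hf hf0 hg hgp hint, norm_mul]
    have h2 : ‖((2 : ℂ) * Complex.I)⁻¹‖ = 2⁻¹ := by simp
    simp_rw [h2, ← norm_mul]
    gcongr
    exact norm_integral_le_integral_norm _
  · rw [Bip, integral_undef hint, norm_zero]
    positivity

theorem Fk_conj (x : ℝ → ℝ) (f : ℝ → ℂ) (k : ℝ) :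
    Fk x (fun y => (starRingEnd ℂ) (f y)) (-k) = (starRingEnd ℂ) (Fk x f k) := by
  rw [Fk, Fk, map_mul, ← integral_conj, map_inv₀, Complex.conj_ofReal]
  congr 1
  refine integral_congr_ae (Eventually.of_forall fun y => ?_)
  dsimp only
  rw [map_mul, ← Complex.exp_conj]
  simp

theorem Aip_eq_conj_Bip (x : ℝ → ℝ) (g f : ℝ → ℂ) :
    Aip x g f = (starRingEnd ℂ) (Bip x g fun y => (starRingEnd ℂ) (f y)) := by
  rw [Aip, Bip, ← integral_conj]
  refine integral_congr_ae (Eventually.of_forall fun k => ?_)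
  dsimp only
  rw [Fk_conj]
  simp [Complex.conj_ofNat]

theorem setIntegral_Iic_norm_le_of_decay {f : ℝ → ℂ} {α C L s : ℝ} (hα : 0 < α)
    (hdecay : ∀ y : ℝ, y ≤ -L → ‖f y‖ ≤ C / |y| ^ (1 + α)) (hs : 0 < s) (hLs : L ≤ s) :
    ∫ u in Iic (-s), ‖f u‖ ≤ C / (α * s ^ α) := by
  have hlt : -(1 + α) < -1 := by linarith
  have hIoi : IntegrableOn (fun u : ℝ => C * u ^ (-(1 + α))) (Ioi s) :=
    (integrableOn_Ioi_rpow_of_lt hlt hs).const_mul C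
  have hIic : IntegrableOn (fun u : ℝ => C * (-u) ^ (-(1 + α))) (Iic (-s)) := by
    have := ((integrableOn_Ici_iff_integrableOn_Ioi).2 hIoi).comp_neg
    simpa using this
  calc
    ∫ u in Iic (-s), ‖f u‖ ≤ ∫ u in Iic (-s), C * (-u) ^ (-(1 + α)) := by
      refine integral_mono_of_nonneg (Eventually.of_forall fun _ => norm_nonneg _) hIic ?_
      filter_upwards [ae_restrict_mem measurableSet_Iic] with u hu
      have hu' : u ≤ -s := hu
      refine (hdecay u (by linarith)).trans_eq ?_
      rw [abs_of_neg (by linarith), Real.rpow_neg (by linarith), div_eq_mul_inv]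
    _ = ∫ u in Ioi s, C * u ^ (-(1 + α)) := by
      rw [integral_comp_neg_Iic (-s) fun u : ℝ => C * u ^ (-(1 + α)), neg_neg]
    _ = C / (α * s ^ α) := by
      rw [integral_const_mul, integral_Ioi_rpow_of_lt hlt hs]
      have : -(1 + α) + 1 = -α := by ring
      rw [this, Real.rpow_neg hs.le]
      field_simp

theorem integral_translate_mul_le {f : ℝ → ℂ} (hf : Integrable f) {K : ℝ → ℝ}
    (hK0 : ∀ y, 0 ≤ K y) {I δ c y₀ : ℝ} (hKI : ∀ y, K y ≤ I) (hδ : 0 ≤ δ)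
    (hKδ : ∀ y, c < y → K y ≤ δ) :
    ∫ y, ‖tr f y₀ y‖ * K y ≤ I * (∫ u in Iic (c - y₀), ‖f u‖) + δ * ∫ u, ‖f u‖ := by
  have hI : 0 ≤ I := (hK0 0).trans (hKI 0)
  have hind : Integrable ((Iic (c - y₀)).indicator fun u => ‖f u‖) :=
    hf.norm.indicator measurableSet_Iic
  rw [← integral_add_right_eq_self (fun y => ‖tr f y₀ y‖ * K y) y₀,
    ← integral_indicator measurableSet_Iic, ← integral_const_mul, ← integral_const_mul,
    ← integral_add (hind.const_mul I) (hf.norm.const_mul δ)]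
  refine integral_mono_of_nonneg (Eventually.of_forall fun u => ?_)
    ((hind.const_mul I).add (hf.norm.const_mul δ)) (Eventually.of_forall fun u => ?_)
  · exact mul_nonneg (norm_nonneg _) (hK0 _)
  · dsimp only [tr, Pi.add_apply]
    rw [add_sub_cancel_right]
    by_cases hu : u ≤ c - y₀
    · rw [indicator_of_mem (mem_Iic.2 hu)]
      nlinarith [mul_le_mul_of_nonneg_left (hKI (u + y₀)) (norm_nonneg (f u)),
        mul_nonneg hδ (norm_nonneg (f u))]
    · rw [indicator_of_notMem (by simpa using hu)]
      nlinarith [mul_le_mul_of_nonneg_left (hKδ (u + y₀) (by linarith)) (norm_nonneg (f u))]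

theorem norm_integral_to_zero_le {g : ℝ → ℂ} (hg : Integrable g) {a : ℝ} (ha : a ≤ 0) :
    ‖∫ t in a..0, g t‖ ≤ ∫ t in Iio (0 : ℝ), ‖g t‖ := by
  refine intervalIntegral.norm_integral_le_integral_norm_uIoc.trans ?_
  rw [uIoc_of_le ha, integral_Ioc_eq_integral_Ioo]
  exact setIntegral_mono_set hg.norm.integrableOn
    (Eventually.of_forall fun _ => norm_nonneg _) (Ioo_subset_Iio_self.eventuallyLE)

theorem exists_norm_integral_to_zero_le_mul {g : ℝ → ℂ} {gL : ℂ}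
    (hgl : Tendsto g (nhdsWithin 0 (Iio 0)) (nhds gL)) :
    ∃ M r : ℝ, 0 ≤ M ∧ 0 < r ∧
      ∀ a, -r < a → a ≤ 0 → ‖∫ t in a..0, g t‖ ≤ M * (-a) := by
  have hev : ∀ᶠ t in nhdsWithin (0 : ℝ) (Iio 0), ‖g t‖ < ‖gL‖ + 1 :=
    hgl.norm.eventually_lt_const (by linarith)
  obtain ⟨l, hl, hlt⟩ := mem_nhdsLT_iff_exists_Ioo_subset.1 hev
  have hl0 : l < 0 := hl
  refine ⟨‖gL‖ + 1, -l, by positivity, by linarith, fun a ha ha0 => ?_⟩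
  rw [intervalIntegral.integral_of_le ha0, integral_Ioc_eq_integral_Ioo]
  refine (norm_setIntegral_le_of_norm_le_const (C := ‖gL‖ + 1) (by simp) fun t ht => ?_).trans_eq ?_
  · exact (hlt ⟨by linarith [ht.1], ht.2⟩ : ‖g t‖ < ‖gL‖ + 1).le
  · simp [Measure.real, ha0]

theorem eventually_exp_neg_half_le {A B L α : ℝ} (hA : 0 ≤ A) (hB : 0 < B) :
    ∀ᶠ y₀ : ℝ in atTop, A * Real.exp (L - y₀ / 2) ≤ B / (y₀ / 2 + L) ^ α := by
  have hs : Tendsto (fun y₀ : ℝ => y₀ / 2 + L) atTop atTop :=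
    tendsto_atTop_add_const_right _ _ (tendsto_id.atTop_div_const two_pos)
  have hpos : 0 < A * Real.exp (2 * L) + 1 := by positivity
  have hlim := (tendsto_rpow_mul_exp_neg_mul_atTop_nhds_zero α 1 one_pos).comp hs
  filter_upwards [hs.eventually_gt_atTop 0,
    hlim.eventually_lt_const (div_pos hB hpos)] with y₀ hy₀ hlt
  have hlt' : (y₀ / 2 + L) ^ α * Real.exp (-1 * (y₀ / 2 + L)) <
    B / (A * Real.exp (2 * L) + 1) := hlt
  rw [lt_div_iff₀ hpos] at hlt'
  rw [le_div_iff₀ (Real.rpow_pos_of_pos hy₀ α)]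
  have hexp : Real.exp (L - y₀ / 2) = Real.exp (2 * L) * Real.exp (-1 * (y₀ / 2 + L)) := by
    rw [← Real.exp_add]
    congr 1
    ring
  rw [hexp]
  have : 0 ≤ (y₀ / 2 + L) ^ α * Real.exp (-1 * (y₀ / 2 + L)) := by positivity
  nlinarith

theorem eventually_norm_Bip_tr_le {x : ℝ → ℝ} (hxm : Measurable x) (hx0 : ∀ y, x y ≤ 0)
    (hxe : ∀ y, -Real.exp (-y) ≤ x y) {f g : ℝ → ℂ} (hf : Integrable f) (hf0 : ∫ y, f y = 0)
    (hg : Integrable g) (hgp : ∀ᵐ k : ℝ, k ≤ 0 → ft g k = 0) {gL : ℂ}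
    (hgl : Tendsto g (nhdsWithin 0 (Iio 0)) (nhds gL)) {α C L : ℝ} (hα : 0 < α) (hC : 0 < C)
    (hdecay : ∀ y : ℝ, y ≤ -L → ‖f y‖ ≤ C / |y| ^ (1 + α)) :
    ∀ᶠ y₀ : ℝ in atTop, ‖Bip x g (tr f y₀)‖ ≤
      (∫ t in Iio (0 : ℝ), ‖g t‖) * (C / (α * (y₀ / 2 + L) ^ α)) := by
  set I := ∫ t in Iio (0 : ℝ), ‖g t‖
  have hI0 : 0 ≤ I := integral_nonneg fun t => norm_nonneg (g t)
  have hKI : ∀ y, ‖∫ t in x y..0, g t‖ ≤ I := fun y => norm_integral_to_zero_le hg (hx0 y)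
  set N := ∫ u, ‖f u‖
  have hN0 : 0 ≤ N := integral_nonneg fun t => norm_nonneg (f t)
  have hdiv : Tendsto (fun y₀ : ℝ => y₀ / 2) atTop atTop := tendsto_id.atTop_div_const two_pos
  have hnear : ∀ᶠ y₀ : ℝ in atTop, ∃ δ : ℝ, 0 ≤ δ ∧
      (∀ y, y₀ / 2 - L < y → ‖∫ t in x y..0, g t‖ ≤ δ) ∧
      δ * N ≤ I * (C / (α * (y₀ / 2 + L) ^ α)) := by
    rcases hI0.eq_or_lt with hI | hI
    · refine Eventually.of_forall fun y₀ => ⟨0, le_rfl, fun y _ => ?_, ?_⟩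
      · exact (hKI y).trans_eq hI.symm
      · simp [← hI]
    · obtain ⟨M, r, hM, hr, hMr⟩ := exists_norm_integral_to_zero_le_mul hgl
      have hexp : Tendsto (fun y₀ : ℝ => Real.exp (L - y₀ / 2)) atTop (nhds 0) :=
        Real.tendsto_exp_atBot.comp
          (tendsto_atBot_add_const_left _ L (tendsto_neg_atTop_atBot.comp hdiv))
      filter_upwards [hexp.eventually_lt_const hr,
        eventually_exp_neg_half_le (L := L) (α := α) (mul_nonneg hM hN0)
          (B := I * (C / α)) (by positivity)] with y₀ hy₀ hle
      refine ⟨M * Real.exp (L - y₀ / 2), by positivity, fun y hy => ?_, ?_⟩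
      · have hle_exp : -x y ≤ Real.exp (L - y₀ / 2) := by
          have : Real.exp (-y) ≤ Real.exp (L - y₀ / 2) := Real.exp_le_exp.2 (by linarith)
          linarith [hxe y]
        exact (hMr (x y) (by linarith) (hx0 y)).trans (by gcongr)
      · calc
          M * Real.exp (L - y₀ / 2) * N = M * N * Real.exp (L - y₀ / 2) := by ring
          _ ≤ I * (C / α) / (y₀ / 2 + L) ^ α := hle
          _ = _ := by rw [← div_div, mul_div_assoc]
  filter_upwards [hnear, eventually_ge_atTop 0,
    (tendsto_atTop_add_const_right _ L hdiv).eventually_gt_atTop 0]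
    with y₀ ⟨δ, hδ, hKδ, hδN⟩ hy₀ hs
  have hftr : Integrable (tr f y₀) := hf.comp_sub_right y₀
  have hftr0 : ∫ y, tr f y₀ y = 0 := (integral_sub_right_eq_self f y₀).trans hf0
  have hmain := integral_translate_mul_le hf (y₀ := y₀) (K := fun y => ‖∫ t in x y..0, g t‖)
    (fun y => norm_nonneg _) hKI hδ hKδ
  have htail : ∫ u in Iic (y₀ / 2 - L - y₀), ‖f u‖ ≤ C / (α * (y₀ / 2 + L) ^ α) := by
    have heq : y₀ / 2 - L - y₀ = -(y₀ / 2 + L) := by ring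
    rw [heq]
    exact setIntegral_Iic_norm_le_of_decay hα hdecay hs (by linarith)
  have hB := norm_Bip_le_integral_primitive hxm hftr hftr0 hg hgp
  have := mul_le_mul_of_nonneg_left htail hI0
  linarith

theorem sum_sq_le_of_le {a b I C α s E : ℝ} (ha0 : 0 ≤ a) (hb0 : 0 ≤ b) (hs : 0 < s)
    (hE : 0 ≤ E) (ha : a ≤ I * (C / (α * s ^ α))) (hb : b ≤ I * (C / (α * s ^ α))) :
    a ^ 2 + b ^ 2 ≤ I ^ 2 * (4 * C ^ 2 / (α ^ 2 * s ^ (2 * α))) + E := by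
  have hpow : s ^ (2 * α) = (s ^ α) ^ 2 := by
    rw [← Real.rpow_natCast, ← Real.rpow_mul hs.le, mul_comm]
    norm_num
  have heq : I ^ 2 * (4 * C ^ 2 / (α ^ 2 * s ^ (2 * α))) = 4 * (I * (C / (α * s ^ α))) ^ 2 := by
    rw [hpow, mul_pow, div_pow, mul_pow]
    ring
  rw [heq]
  nlinarith [pow_le_pow_left₀ ha0 ha 2, pow_le_pow_left₀ hb0 hb 2,
    sq_nonneg (I * (C / (α * s ^ α)))]

theorem xR_props : Measurable xR ∧ (∀ y, xR y ≤ 0) ∧ ∀ y, -Real.exp (-y) ≤ xR y :=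
  ⟨(Real.measurable_exp.comp measurable_neg).neg,
    fun _ => neg_nonpos.2 (Real.exp_pos _).le, fun _ => le_rfl⟩

theorem xC_props : Measurable xC ∧ (∀ y, xC y ≤ 0) ∧ ∀ y, -Real.exp (-y) ≤ xC y := by
  refine ⟨?_, fun y => ?_, fun y => ?_⟩
  · exact (Real.measurable_log.comp
      (measurable_const.add (Real.measurable_exp.comp measurable_neg))).neg
  · exact neg_nonpos.2 (Real.log_nonneg (by linarith [Real.exp_pos (-y)]))
  · have := Real.log_le_sub_one_of_pos (x := 1 + Real.exp (-y)) (by positivity)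
    rw [xC]
    linarith

/-- For `x = x_R` or `x = x_C`, a normalized outgoing wave function `f`
with `|f(y)| ≤ C/|y|^{1+α}` for `y ≤ -L` and a normalized incoming wave function `g`
having a left limit `g(0⁻) = gL`, there is `Y` such that for all `y₀ ≥ Y`,
`|N̄_g[f_{y₀}] - N̄_o[f_{y₀}]| ≤ (∫_{-∞}^0|g|)² · 4C²/(α²(y₀/2+L)^{2α})
  + e^{2L-y₀}(∫|f|)² |g(0⁻)|²`. -/
theorem stmt_13 (x : ℝ → ℝ) (hx : x = xR ∨ x = xC) (f g : ℝ → ℂ)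
    (hf : MeasureTheory.Integrable f)
    (hfp : ∀ᵐ p : ℝ, p ≤ 0 → ft f p = 0)
    (hfn : (∫⁻ p in Set.Ioi (0:ℝ),
        ENNReal.ofReal (‖ft f p‖ ^ 2 / (2 * p))) = 1)
    (hg : MeasureTheory.Integrable g)
    (hgp : ∀ᵐ k : ℝ, k ≤ 0 → ft g k = 0)
    (hgn : (∫⁻ k in Set.Ioi (0:ℝ),
        ENNReal.ofReal (‖ft g k‖ ^ 2 / (2 * k))) = 1)
    (gL : ℂ) (hgl : Filter.Tendsto g (nhdsWithin 0 (Set.Iio 0)) (nhds gL))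
    (α C L : ℝ) (hα : 0 < α) (hC : 0 < C) (hL : 0 ≤ L)
    (hdecay : ∀ y : ℝ, y ≤ -L → ‖f y‖ ≤ C / |y| ^ (1 + α)) :
    ∃ Y : ℝ, ∀ y₀ : ℝ, Y ≤ y₀ →
      Ng x g (tr f y₀) - No x (tr f y₀) ≤
        ENNReal.ofReal ((∫ t in Set.Iio (0:ℝ), ‖g t‖) ^ 2 *
            (4 * C ^ 2 / (α ^ 2 * (y₀ / 2 + L) ^ (2 * α))) +
          Real.exp (2 * L - y₀) * (∫ y : ℝ, ‖f y‖) ^ 2 * ‖gL‖ ^ 2) ∧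
      No x (tr f y₀) - Ng x g (tr f y₀) ≤
        ENNReal.ofReal ((∫ t in Set.Iio (0:ℝ), ‖g t‖) ^ 2 *
            (4 * C ^ 2 / (α ^ 2 * (y₀ / 2 + L) ^ (2 * α))) +
          Real.exp (2 * L - y₀) * (∫ y : ℝ, ‖f y‖) ^ 2 * ‖gL‖ ^ 2) := by
  obtain ⟨hxm, hx0, hxe⟩ :
      Measurable x ∧ (∀ y, x y ≤ 0) ∧ ∀ y, -Real.exp (-y) ≤ x y := by
    rcases hx with rfl | rfl
    · exact xR_props
    · exact xC_props
  have hf0 := integral_eq_zero_of_ft_ae_eq_zero hf hfp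
  have hcf : Integrable fun y => (starRingEnd ℂ) (f y) :=
    (Complex.conjLIE.integrable_comp_iff).2 hf
  have hcf0 : ∫ y, (starRingEnd ℂ) (f y) = 0 := by rw [integral_conj, hf0, map_zero]
  have hs : Tendsto (fun y₀ : ℝ => y₀ / 2 + L) atTop atTop :=
    tendsto_atTop_add_const_right _ _ (tendsto_id.atTop_div_const two_pos)
  refine eventually_atTop.1 ?_
  filter_upwards [eventually_norm_Bip_tr_le hxm hx0 hxe hf hf0 hg hgp hgl hα hC hdecay,
    eventually_norm_Bip_tr_le hxm hx0 hxe hcf hcf0 hg hgp hgl hα hC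
      (fun y hy => by rw [RCLike.norm_conj]; exact hdecay y hy),
    hs.eventually_gt_atTop 0] with y₀ hB hA hpos
  have hA' : ‖Aip x g (tr f y₀)‖ ≤
      (∫ t in Iio (0 : ℝ), ‖g t‖) * (C / (α * (y₀ / 2 + L) ^ α)) := by
    rw [Aip_eq_conj_Bip, RCLike.norm_conj]
    exact hA
  constructor
  · rw [Ng, add_assoc, ← ENNReal.ofReal_add (by positivity) (by positivity)]
    refine tsub_le_iff_left.2 ?_
    refine add_le_add_right (ENNReal.ofReal_le_ofReal ?_) _
    exact sum_sq_le_of_le (norm_nonneg _) (norm_nonneg _) hpos (by positivity) hA' hB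
  · rw [tsub_eq_zero_of_le]
    · exact zero_le
    · rw [Ng, add_assoc]
      exact le_self_add
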